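/- Fix integers l ≥ 1, k ≥ 1 with m = kl ≥ 2, an integer n ≥ 0, and d ∈ ℤ^{ℤ/mℤ} with Σ_{j∈ℤ/mℤ} d_j = nl. Let λ be the unique m-core such that Res_m(λ) − d is an integer multiple of δ_m. Then the following are equivalent: (a) for every i ∈ ℤ/lℤ one has Σ_{j∈ℤ/mℤ, j ≡ i (mod l)} d_j = n; (b) the l-core of λ is trivial, i.e. Core_l(λ) = ∅. -/

import Mathlib

/-- The `m`-residue of a box `(r, s)` of a Young diagram (0-based row `r`, column `s`). -/
def boxRes (m : ℕ) (c : ℕ × ℕ) : ZMod m := (c.2 : ZMod m) - (c.1 : ZMod m)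

/-- `Res_m(λ) ∈ ℤ^{ℤ/mℤ}`. -/
def Res (m : ℕ) (lam : YoungDiagram) : ZMod m → ℤ :=
  fun i => ((lam.cells.filter fun c => boxRes m c = i).card : ℤ)

/-- One step: `μ` is obtained from `λ` by removing exactly `m` boxes with pairwise
distinct `m`-residues. -/
def RemoveStep (m : ℕ) (lam mu : YoungDiagram) : Prop :=
  mu ≤ lam ∧ (lam.cells \ mu.cells).card = m ∧
    Set.InjOn (boxRes m) ↑(lam.cells \ mu.cells)

/-- `ν` can be obtained from `λ` by a finite sequence of `m`-box removal steps. -/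
def Reaches (m : ℕ) (lam nu : YoungDiagram) : Prop :=
  Relation.ReflTransGen (fun a b => RemoveStep m a b) lam nu

/-- `λ` is an `m`-core. -/
def IsCore (m : ℕ) (lam : YoungDiagram) : Prop :=
  ¬ ∃ mu : YoungDiagram, RemoveStep m lam mu

/-- The `t`-th cell on the diagonal of content `j`. -/
def diagCell (j : ℤ) (t : ℕ) : ℕ × ℕ := (t + (-j).toNat, t + j.toNat)

theorem exists_diagCell_notMem (lam : YoungDiagram) (j : ℤ) : ∃ t, diagCell j t ∉ lam := by
  by_contra! h
  have hinj : Function.Injective (diagCell j) := fun a b hab => by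
    simp only [diagCell, Prod.mk.injEq] at hab
    omega
  exact Set.infinite_of_injective_forall_mem (s := (lam.cells : Set (ℕ × ℕ))) hinj h
    lam.cells.finite_toSet

open Classical in
/-- The number of cells of content `j` in `lam`. -/
noncomputable def diagLength (lam : YoungDiagram) (j : ℤ) : ℕ :=
  Nat.find (exists_diagCell_notMem lam j)

theorem diagCell_mem_iff (lam : YoungDiagram) (j : ℤ) (t : ℕ) :
    diagCell j t ∈ lam ↔ t < diagLength lam j := by
  classical
  rw [diagLength, Nat.lt_find_iff]
  refine ⟨fun h s hs => ?_, fun h => not_not.1 (h t le_rfl)⟩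
  exact not_not.2 (lam.up_left_mem (by omega) (by omega) h)

theorem mem_iff_min_lt_diagLength (lam : YoungDiagram) (r s : ℕ) :
    (r, s) ∈ lam ↔ min r s < diagLength lam ((s : ℤ) - r) := by
  rw [← diagCell_mem_iff]
  have : diagCell ((s : ℤ) - r) (min r s) = (r, s) := by
    simp only [diagCell, Prod.mk.injEq]
    omega
  rw [this]

theorem card_filter_content (lam : YoungDiagram) (j : ℤ) :
    (lam.cells.filter fun p => (p.2 : ℤ) - p.1 = j).card = diagLength lam j := by
  rw [← Finset.card_range (diagLength lam j)]
  symm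
  refine Finset.card_bij (fun t _ => diagCell j t) ?_ ?_ ?_
  · intro t ht
    rw [Finset.mem_filter, YoungDiagram.mem_cells, diagCell_mem_iff]
    refine ⟨Finset.mem_range.1 ht, ?_⟩
    simp only [diagCell]
    omega
  · intro a _ b _ hab
    simp only [diagCell, Prod.mk.injEq] at hab
    omega
  · rintro ⟨r, s⟩ hp
    rw [Finset.mem_filter, YoungDiagram.mem_cells, mem_iff_min_lt_diagLength] at hp
    obtain ⟨hp, rfl⟩ := hp
    refine ⟨min r s, Finset.mem_range.2 hp, ?_⟩
    simp only [diagCell, Prod.mk.injEq]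
    omega

theorem diagLength_slope_of_nonneg (lam : YoungDiagram) {j : ℤ} (hj : 0 ≤ j) :
    diagLength lam (j + 1) ≤ diagLength lam j ∧
      diagLength lam j ≤ diagLength lam (j + 1) + 1 := by
  constructor <;> by_contra! h
  · rw [← diagCell_mem_iff] at h
    refine lt_irrefl _ ((diagCell_mem_iff lam j _).1 (lam.up_left_mem ?_ ?_ h)) <;> omega
  · rw [← diagCell_mem_iff] at h
    refine lt_irrefl _ ((diagCell_mem_iff lam (j + 1) _).1 (lam.up_left_mem ?_ ?_ h)) <;> omega

theorem diagLength_slope_of_neg (lam : YoungDiagram) {j : ℤ} (hj : j < 0) :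
    diagLength lam j ≤ diagLength lam (j + 1) ∧
      diagLength lam (j + 1) ≤ diagLength lam j + 1 := by
  constructor <;> by_contra! h
  · rw [← diagCell_mem_iff] at h
    refine lt_irrefl _ ((diagCell_mem_iff lam (j + 1) _).1 (lam.up_left_mem ?_ ?_ h)) <;> omega
  · rw [← diagCell_mem_iff] at h
    refine lt_irrefl _ ((diagCell_mem_iff lam j _).1 (lam.up_left_mem ?_ ?_ h)) <;> omega

theorem diagLength_antitone_of_nonneg (lam : YoungDiagram) {i : ℤ} (hi : 0 ≤ i) (t : ℕ) :
    diagLength lam (i + t) ≤ diagLength lam i := by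
  induction t with
  | zero => simp
  | succ t ih =>
    have := (diagLength_slope_of_nonneg lam (j := i + t) (by omega)).1
    push_cast
    rw [← add_assoc]
    omega

theorem diagLength_monotone_of_nonpos (lam : YoungDiagram) {i : ℤ} (t : ℕ) (hi : i + t ≤ 0) :
    diagLength lam i ≤ diagLength lam (i + t) := by
  induction t with
  | zero => simp
  | succ t ih =>
    have h1 := (diagLength_slope_of_neg lam (j := i + t) (by omega)).1
    have h2 := ih (by omega)
    push_cast
    rw [← add_assoc]
    omega

theorem lowerSet_of_step (s : Finset (ℕ × ℕ)) (h1 : ∀ a b, (a + 1, b) ∈ s → (a, b) ∈ s)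
    (h2 : ∀ a b, (a, b + 1) ∈ s → (a, b) ∈ s) : IsLowerSet (s : Set (ℕ × ℕ)) := by
  have key1 : ∀ t a b, (a + t, b) ∈ s → (a, b) ∈ s := by
    intro t
    induction t with
    | zero => exact fun a b h => h
    | succ t ih => exact fun a b h => ih a b (h1 _ _ h)
  have key2 : ∀ t a b, (a, b + t) ∈ s → (a, b) ∈ s := by
    intro t
    induction t with
    | zero => exact fun a b h => h
    | succ t ih => exact fun a b h => ih a b (h2 _ _ h)
  rintro ⟨a, b⟩ ⟨c, e⟩ ⟨hc, he⟩ h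
  simp only at hc he
  obtain ⟨u, rfl⟩ := Nat.exists_eq_add_of_le hc
  obtain ⟨v, rfl⟩ := Nat.exists_eq_add_of_le he
  exact key1 u _ _ (key2 v _ _ h)

/-- The content `j` is occupied by a bead of the Maya diagram of `lam`. -/
def IsBead (lam : YoungDiagram) (j : ℤ) : Prop :=
  0 ≤ j ∧ diagLength lam (j + 1) < diagLength lam j ∨
    j < 0 ∧ diagLength lam (j + 1) = diagLength lam j

theorem diagLength_pos_of_bead (lam : YoungDiagram) (l : ℕ) {x : ℤ} (hx : ¬ IsBead lam x)
    (hxl : IsBead lam (x + l)) {j : ℤ} (h1 : x < j) (h2 : j ≤ x + l) :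
    0 < diagLength lam j := by
  rcases le_or_gt 0 j with hj | hj
  · have h : 0 < diagLength lam (x + l) := by
      rcases hxl with h | h <;> omega
    obtain ⟨t, ht⟩ := Int.le.dest h2
    rw [← ht] at h
    exact h.trans_le (diagLength_antitone_of_nonneg lam hj t)
  · have h : 0 < diagLength lam (x + 1) := by
      have := diagLength_slope_of_neg lam (j := x) (by omega)
      by_contra h0
      exact hx (Or.inr ⟨by omega, by omega⟩)
    obtain ⟨t, ht⟩ := Int.le.dest (show x + 1 ≤ j by omega)
    have := diagLength_monotone_of_nonpos lam (i := x + 1) t (by omega)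
    rw [ht] at this
    omega

/-- Moving a bead down by `l` positions removes a rim hook of length `l`. -/
theorem exists_removeStep_of_bead (lam : YoungDiagram) (l : ℕ) {x : ℤ} (hx : ¬ IsBead lam x)
    (hxl : IsBead lam (x + l)) : ∃ mu, RemoveStep l lam mu := by
  classical
  set R : Finset (ℕ × ℕ) := (Finset.Ioc x (x + l)).image
    fun j => diagCell j (diagLength lam j - 1) with hR
  have hpos : ∀ j, x < j → j ≤ x + l → 0 < diagLength lam j :=
    fun j h1 h2 => diagLength_pos_of_bead lam l hx hxl h1 h2
  have memR : ∀ r s : ℕ, (r, s) ∈ R ↔ (x < (s : ℤ) - r ∧ (s : ℤ) - r ≤ x + l) ∧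
      min r s = diagLength lam ((s : ℤ) - r) - 1 := by
    intro r s
    simp only [hR, Finset.mem_image, Finset.mem_Ioc, diagCell, Prod.mk.injEq]
    constructor
    · rintro ⟨j, hj, h1, h2⟩
      have : (s : ℤ) - r = j := by omega
      rw [this]
      omega
    · rintro ⟨hj, h⟩
      exact ⟨(s : ℤ) - r, hj, by omega, by omega⟩
  have hRsub : R ⊆ lam.cells := by
    rintro ⟨r, s⟩ h
    rw [memR] at h
    rw [YoungDiagram.mem_cells, mem_iff_min_lt_diagLength]
    have := hpos _ h.1.1 h.1.2
    omega
  have memD : ∀ r s : ℕ, (r, s) ∈ lam.cells \ R ↔ min r s < diagLength lam ((s : ℤ) - r) ∧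
      ((x < (s : ℤ) - r ∧ (s : ℤ) - r ≤ x + l) →
        min r s + 1 < diagLength lam ((s : ℤ) - r)) := by
    intro r s
    rw [Finset.mem_sdiff, YoungDiagram.mem_cells, mem_iff_min_lt_diagLength, memR]
    have := hpos ((s : ℤ) - r)
    omega
  have slope : ∀ j : ℤ,
      (0 ≤ j → diagLength lam (j + 1) ≤ diagLength lam j ∧
        diagLength lam j ≤ diagLength lam (j + 1) + 1) ∧
      (j < 0 → diagLength lam j ≤ diagLength lam (j + 1) ∧
        diagLength lam (j + 1) ≤ diagLength lam j + 1) :=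
    fun j => ⟨diagLength_slope_of_nonneg lam, diagLength_slope_of_neg lam⟩
  have hx' : ∀ j, j = x → ¬ (0 ≤ j ∧ diagLength lam (j + 1) < diagLength lam j ∨
    j < 0 ∧ diagLength lam (j + 1) = diagLength lam j) := by
    rintro j rfl
    exact hx
  have hxl' : ∀ j, j = x + l → (0 ≤ j ∧ diagLength lam (j + 1) < diagLength lam j ∨
    j < 0 ∧ diagLength lam (j + 1) = diagLength lam j) := by
    rintro j rfl
    exact hxl
  have hlow : IsLowerSet ((lam.cells \ R : Finset (ℕ × ℕ)) : Set (ℕ × ℕ)) := by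
    apply lowerSet_of_step
    · intro r s h
      rw [memD] at h ⊢
      obtain ⟨j, hj⟩ : ∃ j : ℤ, j = (s : ℤ) - (r + 1 : ℕ) := ⟨_, rfl⟩
      have e2 : (s : ℤ) - r = j + 1 := by omega
      rw [← hj] at h
      rw [e2]
      have h1 := slope j
      have h2 := hx' j
      have h3 := hxl' j
      omega
    · intro r s h
      rw [memD] at h ⊢
      obtain ⟨j, hj⟩ : ∃ j : ℤ, j = (s : ℤ) - r := ⟨_, rfl⟩
      have e2 : ((s + 1 : ℕ) : ℤ) - r = j + 1 := by omega
      rw [e2] at h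
      rw [← hj]
      have h1 := slope j
      have h2 := hx' j
      have h3 := hxl' j
      omega
  refine ⟨⟨lam.cells \ R, hlow⟩, Finset.sdiff_subset, ?_, ?_⟩
  · rw [show lam.cells \ (lam.cells \ R) = R from Finset.sdiff_sdiff_eq_self hRsub,
      hR, Finset.card_image_of_injOn, Int.card_Ioc]
    · simp
    · intro i _ j _ hij
      simp only [diagCell, Prod.mk.injEq] at hij
      omega
  · rw [show lam.cells \ (lam.cells \ R) = R from Finset.sdiff_sdiff_eq_self hRsub]
    rintro ⟨r, s⟩ h ⟨r', s'⟩ h' heq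
    rw [Finset.mem_coe, memR] at h h'
    have hc : (((s : ℤ) - r : ℤ) : ZMod l) = (((s' : ℤ) - r' : ℤ) : ZMod l) := by
      simpa [boxRes] using heq
    rw [ZMod.intCast_eq_intCast_iff_dvd_sub] at hc
    have he : ((s' : ℤ) - r') - (s - r) = 0 := by
      apply Int.eq_zero_of_abs_lt_dvd hc
      rw [abs_lt]
      omega
    have he : (s' : ℤ) - r' = s - r := by omega
    rw [he] at h'
    simp only [Prod.mk.injEq]
    omega

theorem res_eq_sum_diagLength (lam : YoungDiagram) (l : ℕ) (i : ZMod l) (z : ℤ) {S : Finset ℤ}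
    (hS : ∀ p ∈ lam.cells, (p.2 : ℤ) - p.1 - z ∈ S) :
    Res l lam (i + z) =
      ∑ j ∈ S.filter (fun j : ℤ => (j : ZMod l) = i), (diagLength lam (j + z) : ℤ) := by
  rw [Res, Finset.card_eq_sum_card_fiberwise (f := fun p : ℕ × ℕ => (p.2 : ℤ) - p.1 - z)
    (t := S.filter (fun j : ℤ => (j : ZMod l) = i))]
  · push_cast
    refine Finset.sum_congr rfl fun j hj => ?_
    rw [← card_filter_content, Finset.filter_filter]
    congr 2
    ext p
    simp only [Finset.mem_filter] at hj ⊢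
    simp only [boxRes]
    refine and_congr_right fun _ => ⟨fun h => by omega, fun h => ⟨?_, by omega⟩⟩
    have := congrArg (fun t : ℤ => (t : ZMod l)) h
    push_cast at this
    rw [this, hj.2]
  · intro p hp
    rw [Finset.mem_coe, Finset.mem_filter] at hp ⊢
    refine ⟨hS p hp.1, ?_⟩
    have h2 := hp.2
    rw [boxRes] at h2
    push_cast
    rw [h2]
    ring

theorem exists_bead_of_ne_bot (lam : YoungDiagram) (h : lam ≠ ⊥) :
    ∃ b : ℤ, 0 ≤ b ∧ diagLength lam (b + 1) < diagLength lam b := by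
  by_contra! hb
  have hpos : 0 < diagLength lam 0 := by
    rw [← diagCell_mem_iff]
    obtain ⟨p, hp⟩ : lam.cells.Nonempty := by
      rw [Finset.nonempty_iff_ne_empty]
      exact fun h0 => h (YoungDiagram.ext h0)
    exact lam.up_left_mem (i2 := p.1) (j2 := p.2) (by simp) (by simp) hp
  have hall : ∀ t : ℕ, (0, t) ∈ lam.cells := by
    intro t
    have ht : 0 < diagLength lam t := by
      induction t with
      | zero => exact hpos
      | succ t ih =>
        push_cast
        exact ih.trans_le (hb t (by omega))
    rw [YoungDiagram.mem_cells, mem_iff_min_lt_diagLength]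
    simpa using ht
  exact Set.infinite_of_injective_forall_mem (s := (lam.cells : Set (ℕ × ℕ)))
    (f := fun t : ℕ => (0, t)) (fun a b hab => by simpa using hab) hall lam.cells.finite_toSet

/-- A nonempty diagram with equidistributed `l`-residues is not an `l`-core. -/
theorem exists_removeStep_of_res_const (lam : YoungDiagram) (l : ℕ) [NeZero l] (N : ℤ)
    (hN : ∀ i, Res l lam i = N) (h : lam ≠ ⊥) : ∃ mu, RemoveStep l lam mu := by
  classical
  obtain ⟨b, hb0, hb⟩ := exists_bead_of_ne_bot lam h
  obtain ⟨S, hbS, hS0, hS1⟩ : ∃ S : Finset ℤ, b ∈ S ∧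
      (∀ p ∈ lam.cells, (p.2 : ℤ) - p.1 - 0 ∈ S) ∧
      ∀ p ∈ lam.cells, (p.2 : ℤ) - p.1 - 1 ∈ S := by
    refine ⟨insert b (lam.cells.image (fun p => (p.2 : ℤ) - p.1 - 0) ∪
      lam.cells.image (fun p => (p.2 : ℤ) - p.1 - 1)), Finset.mem_insert_self _ _,
      fun p hp => ?_, fun p hp => ?_⟩
    · exact Finset.mem_insert_of_mem (Finset.mem_union_left _
        (Finset.mem_image_of_mem (fun p : ℕ × ℕ => (p.2 : ℤ) - p.1 - 0) hp))
    · exact Finset.mem_insert_of_mem (Finset.mem_union_right _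
        (Finset.mem_image_of_mem (fun p : ℕ × ℕ => (p.2 : ℤ) - p.1 - 1) hp))
  have hsum := (res_eq_sum_diagLength lam l b 1 hS1).symm.trans
    ((hN _).trans ((hN _).symm.trans (res_eq_sum_diagLength lam l b 0 hS0)))
  obtain ⟨j, hjb, hj⟩ : ∃ j : ℤ, (j : ZMod l) = b ∧
      diagLength lam j < diagLength lam (j + 1) := by
    by_contra! hcon
    refine hsum.not_lt (Finset.sum_lt_sum (fun j hj => ?_)
      ⟨b, Finset.mem_filter.2 ⟨hbS, rfl⟩, ?_⟩)
    · rw [add_zero]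
      exact_mod_cast hcon j (Finset.mem_filter.1 hj).2
    · rw [add_zero]
      exact_mod_cast hb
  have hjneg : j < 0 := by
    by_contra! hj0
    have := diagLength_slope_of_nonneg lam hj0
    omega
  have hjn : ¬ IsBead lam j := by
    rintro (h | h) <;> omega
  rw [ZMod.intCast_eq_intCast_iff_dvd_sub] at hjb
  obtain ⟨q, hq⟩ := hjb
  have hl : (0 : ℤ) < l := by exact_mod_cast Nat.pos_of_ne_zero (NeZero.ne l)
  have hq0 : 0 ≤ q := by
    by_contra! hq0
    nlinarith
  lift q to ℕ using hq0
  have hbb : IsBead lam (j + l * q) := by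
    rw [← hq]
    exact Or.inl ⟨by omega, by simpa using hb⟩
  clear hq
  by_contra! hcon
  have : ∀ t : ℕ, ¬ IsBead lam (j + l * t) := by
    intro t
    induction t with
    | zero => simpa using hjn
    | succ t ih =>
      intro hbead
      obtain ⟨mu, hmu⟩ := exists_removeStep_of_bead lam l ih
        (by convert hbead using 1; push_cast; ring)
      exact hcon mu hmu
  exact this q hbb

theorem RemoveStep.res_eq {l : ℕ} [NeZero l] {lam mu : YoungDiagram} (h : RemoveStep l lam mu)
    (i : ZMod l) : Res l lam i = Res l mu i + 1 := by
  classical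
  obtain ⟨hle, hcard, hinj⟩ := h
  have hsurj : (lam.cells \ mu.cells).image (boxRes l) = Finset.univ := by
    rw [← Finset.card_eq_iff_eq_univ, Finset.card_image_of_injOn hinj, hcard, ZMod.card]
  obtain ⟨p, hp, hpi⟩ := Finset.mem_image.1 (hsurj.symm ▸ Finset.mem_univ i)
  have hone : (lam.cells \ mu.cells).filter (fun c => boxRes l c = i) = {p} := by
    ext q
    rw [Finset.mem_filter, Finset.mem_singleton]
    refine ⟨fun hq => hinj hq.1 hp (hq.2.trans hpi.symm), ?_⟩
    rintro rfl
    exact ⟨hp, hpi⟩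
  have hsub : mu.cells ⊆ lam.cells := hle
  simp only [Res]
  rw [← Finset.sdiff_union_of_subset hsub, Finset.filter_union, Finset.card_union_of_disjoint,
    hone, Finset.card_singleton]
  · push_cast
    ring
  · exact Finset.disjoint_filter_filter Finset.sdiff_disjoint

theorem reaches_bot_iff_res_const (l : ℕ) [NeZero l] (lam : YoungDiagram) :
    Reaches l lam ⊥ ↔ ∃ N : ℤ, ∀ i, Res l lam i = N := by
  constructor
  · intro h
    induction h using Relation.ReflTransGen.head_induction_on with
    | refl => exact ⟨0, fun i => by simp [Res]⟩
    | head hstep _ ih =>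
      obtain ⟨N, hN⟩ := ih
      exact ⟨N + 1, fun i => by rw [hstep.res_eq, hN]⟩
  · rintro ⟨N, hN⟩
    induction hn : lam.card using Nat.strong_induction_on generalizing lam N with
    | _ n ih =>
      by_cases hbot : lam = ⊥
      · rw [hbot]
        exact Relation.ReflTransGen.refl
      obtain ⟨mu, hmu⟩ := exists_removeStep_of_res_const lam l N hN hbot
      refine Relation.ReflTransGen.head hmu (ih mu.card ?_ mu (N - 1) (fun i => ?_) rfl)
      · have h1 := Finset.card_sdiff_add_card_eq_card (show mu.cells ⊆ lam.cells from hmu.1)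
        have h2 := hmu.2.1
        have h3 := NeZero.ne l
        simp only [YoungDiagram.card] at hn ⊢
        omega
      · rw [← hN i, hmu.res_eq i]
        ring

theorem sum_fiber_res (l k : ℕ) [NeZero l] [NeZero k] (lam : YoungDiagram) (i : ZMod l) :
    ∑ j ∈ Finset.univ.filter (fun j : ZMod (k * l) => ((j.val : ZMod l) = i)),
      Res (k * l) lam j = Res l lam i := by
  classical
  have hcast : ∀ c, ((boxRes (k * l) c).val : ZMod l) = boxRes l c := by
    intro c
    rw [ZMod.natCast_val, boxRes, ZMod.cast_sub (Dvd.intro_left k rfl),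
      ZMod.cast_natCast (Dvd.intro_left k rfl), ZMod.cast_natCast (Dvd.intro_left k rfl), boxRes]
  simp only [Res]
  rw [Finset.card_eq_sum_card_fiberwise (f := boxRes (k * l))
    (s := lam.cells.filter fun c => boxRes l c = i)
    (t := Finset.univ.filter (fun j : ZMod (k * l) => ((j.val : ZMod l) = i)))]
  · push_cast
    refine Finset.sum_congr rfl fun j hj => ?_
    rw [Finset.filter_filter]
    congr 2
    ext c
    simp only [Finset.mem_filter, Finset.mem_univ, true_and] at hj ⊢
    refine and_congr_right fun _ => ⟨?_, fun h => h.2⟩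
    rintro rfl
    exact ⟨by rw [← hcast, hj], rfl⟩
  · intro c hc
    simp only [Finset.coe_filter, Set.mem_ofPred_eq, Finset.mem_univ, true_and] at hc ⊢
    rw [hcast, hc.2]

theorem card_fiber_eq (l k : ℕ) [NeZero l] [NeZero k] (i : ZMod l) :
    (Finset.univ.filter (fun j : ZMod (k * l) => ((j.val : ZMod l) = i))).card =
      (Finset.univ.filter (fun j : ZMod (k * l) => ((j.val : ZMod l) = 0))).card := by
  have hsurj : Function.Surjective (ZMod.castHom (Dvd.intro_left k rfl : l ∣ k * l) (ZMod l)) :=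
    ZMod.castHom_surjective _
  have := AddMonoidHom.card_fiber_eq_of_mem_range
    (ZMod.castHom (Dvd.intro_left k rfl : l ∣ k * l) (ZMod l)).toAddMonoidHom
    (x := i) (y := 0) (hsurj i) (hsurj 0)
  simp only [ZMod.natCast_val]
  convert this using 1 <;> congr 1

/-- With `m = kl ≥ 2`, `d ∈ ℤ^{ℤ/mℤ}` with `Σ d_j = nl`, and `λ` the unique `m`-core with
`Res_m(λ) ≡ d mod ℤδ_m`: every fiber sum `Σ_{j ≡ i (mod l)} d_j` equals `n` iff the
`l`-core of `λ` is trivial. -/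
theorem fiber_sums_iff_trivial_l_core (l k : ℕ) [NeZero l] [NeZero k]
    (hl : 1 ≤ l) (hk : 1 ≤ k) (hm : 2 ≤ k * l) (n : ℕ)
    (d : ZMod (k * l) → ℤ) (hsum : ∑ j : ZMod (k * l), d j = (n : ℤ) * (l : ℤ))
    (lam : YoungDiagram) (hcore : IsCore (k * l) lam)
    (hres : ∃ c : ℤ, ∀ i : ZMod (k * l), Res (k * l) lam i - d i = c) :
    (∀ i : ZMod l,
        ∑ j ∈ Finset.univ.filter (fun j : ZMod (k * l) => ((j.val : ZMod l) = i)), d j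
          = (n : ℤ)) ↔
      Reaches l lam ⊥ := by
  obtain ⟨c, hc⟩ := hres
  set K : ℤ := ((Finset.univ.filter
    (fun j : ZMod (k * l) => ((j.val : ZMod l) = 0))).card : ℤ) with hK
  have hfib : ∀ i : ZMod l,
      ∑ j ∈ Finset.univ.filter (fun j : ZMod (k * l) => ((j.val : ZMod l) = i)), d j
        = Res l lam i - K * c := by
    intro i
    rw [← sum_fiber_res l k, hK, ← card_fiber_eq l k i, ← nsmul_eq_mul, ← Finset.sum_const,
      ← Finset.sum_sub_distrib]
    refine Finset.sum_congr rfl fun j _ => ?_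
    rw [← hc j]
    ring
  rw [reaches_bot_iff_res_const]
  simp only [hfib]
  constructor
  · exact fun h => ⟨n + K * c, fun i => by rw [← h i]; ring⟩
  · rintro ⟨N, hN⟩ i
    have htot : ∑ i : ZMod l, (Res l lam i - K * c) = (n : ℤ) * l := by
      rw [← hsum, ← Finset.sum_fiberwise Finset.univ
        (fun j : ZMod (k * l) => ((j.val : ZMod l)))]
      exact Finset.sum_congr rfl fun i _ => (hfib i).symm
    simp only [hN, Finset.sum_const, Finset.card_univ, ZMod.card, nsmul_eq_mul] at htot
    have hl0 : (l : ℤ) ≠ 0 := by exact_mod_cast NeZero.ne l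
    rw [hN i]
    exact mul_left_cancel₀ hl0 (by rw [htot, mul_comm])
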